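/- arXiv:0901.3182 — 2 statements merged into one kernel-verified Lean document; each statement's English description precedes it below -/
import Mathlib

section
/- Let p be an odd prime, let G be a finite p-group such that G/Z(G) has nilpotency class at most 2, and let N be a nontrivial normal subgroup of G such that the quotient G/N is not cyclic. Then there exists a map f : G → G such that: (i) for every g ∈ G, f(g) lies in Z(N) = {n ∈ N : n commutes with every element of N}; (ii) f(xy) = (y⁻¹ f(x) y) · f(y) for all x, y ∈ G; (iii) f(n) = 1 for all n ∈ N; and (iv) there is no a ∈ Z(N) with f(g) = a⁻¹ · (g⁻¹ a g) for all g ∈ G. (This expresses that H¹(G/N, Z(N)) ≠ 0; it is the n = 1 instance of the paper's conclusion that the Tate cohomology Hⁿ(G/N, Z(N)) ≠ 0 for all n ≥ 0.) -/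
lemma one_add_pow_of_cube_eq_zero {R : Type*} [CommRing R] {X : R} (hX : X ^ 3 = 0) (n : ℕ) :
    (1 + X) ^ n = 1 + n * X + n.choose 2 * X ^ 2 := by
  induction n with
  | zero => simp
  | succ n ih =>
    have h : (n + 1).choose 2 = n + n.choose 2 := by simp [Nat.choose_succ_succ']
    rw [pow_succ, ih, h]
    push_cast
    linear_combination (n.choose 2 : R) * hX

lemma geom_sum_of_cube_eq_zero {R : Type*} [CommRing R] {X : R} (hX : X ^ 3 = 0) (n : ℕ) :
    ∑ i ∈ Finset.range n, (1 + X) ^ i = n + n.choose 2 * X + n.choose 3 * X ^ 2 := by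
  induction n with
  | zero => simp
  | succ n ih =>
    have h : (n + 1).choose 2 = n + n.choose 2 := by simp [Nat.choose_succ_succ']
    have h' : (n + 1).choose 3 = n.choose 2 + n.choose 3 := by simp [Nat.choose_succ_succ']
    rw [Finset.sum_range_succ, ih, one_add_pow_of_cube_eq_zero hX, h, h']
    push_cast
    ring

lemma natCast_mul_eq_zero_of_one_add_pow_eq_one {R : Type*} [CommRing R] {X : R}
    (hX : X ^ 3 = 0) {p : ℕ} (hodd : Odd p) (h : (1 + X) ^ p = 1) : (p : R) * X = 0 := by
  rw [one_add_pow_of_cube_eq_zero hX] at h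
  obtain ⟨m, rfl⟩ := hodd
  have hc : (2 * m + 1).choose 2 = (2 * m + 1) * m := by
    rw [Nat.choose_two_right, Nat.add_sub_cancel, mul_left_comm, Nat.mul_div_cancel_left _ two_pos]
  rw [hc] at h
  push_cast at h ⊢
  linear_combination (1 - m * X) * h + (2 * m + 1) * m ^ 2 * hX

lemma geom_sum_of_one_add_pow_eq_one {R : Type*} [CommRing R] {X : R}
    (hX : X ^ 3 = 0) {p : ℕ} (hodd : Odd p) (h : (1 + X) ^ p = 1) :
    ∑ i ∈ Finset.range p, (1 + X) ^ i = p + p.choose 3 * X ^ 2 := by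
  have hpX := natCast_mul_eq_zero_of_one_add_pow_eq_one hX hodd h
  rw [geom_sum_of_cube_eq_zero hX]
  obtain ⟨m, rfl⟩ := hodd
  have hc : (2 * m + 1).choose 2 = (2 * m + 1) * m := by
    rw [Nat.choose_two_right, Nat.add_sub_cancel, mul_left_comm, Nat.mul_div_cancel_left _ two_pos]
  rw [hc]
  push_cast at hpX ⊢
  linear_combination m * hpX

/-- Two endomorphisms of a finite module with zero composite: exactness at one spot of the
resulting periodic complex forces exactness at the other. -/
lemma LinearMap.ker_le_range_of_ker_le_range {R M : Type*} [CommRing R] [AddCommGroup M]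
    [Module R M] [Finite M] {f g : M →ₗ[R] M} (h : ker g ≤ range f) (hfg : range g ≤ ker f) :
    ker f ≤ range g := by
  have card (φ : M →ₗ[R] M) : Nat.card (ker φ) * Nat.card (range φ) = Nat.card M := by
    rw [← Nat.card_congr φ.quotKerEquivRange.toEquiv]
    exact ((ker φ).card_eq_card_quotient_mul_card).symm
  have h1 : Nat.card (ker g) ≤ Nat.card (range f) := Nat.card_mono (Set.toFinite _) h
  have h2 : Nat.card (ker f) ≤ Nat.card (range g) := by
    by_contra! hlt
    have hpos : 0 < Nat.card (range f) := Nat.card_pos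
    have := card f
    have := card g
    nlinarith [Nat.mul_le_mul_right (Nat.card (range g)) h1,
      Nat.mul_lt_mul_of_pos_left hlt hpos]
  exact (Set.eq_of_subset_of_ncard_le hfg h2 (Set.toFinite _)).ge

/-- A finite `p`-primary module over `ℤ[C_p × C_p]`, with the two generators acting as `1 + X` and
`1 + Y`, is trivial if its first cohomology vanishes and it is killed by the third power of
the augmentation ideal. -/
lemma eq_zero_of_crossedHom_principal {R B : Type*} [CommRing R] [AddCommGroup B] [Module R B]
    [Finite B] {p : ℕ} (hodd : Odd p) {X Y : R} (hXXX : X ^ 3 = 0) (hXXY : X ^ 2 * Y = 0)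
    (hYYY : Y ^ 3 = 0) (hXp : (1 + X) ^ p = 1) (hYp : (1 + Y) ^ p = 1)
    {n : ℕ} (hn : ∀ b : B, p ^ n • b = 0)
    (H : ∀ u v : B, (∑ i ∈ Finset.range p, (1 + X) ^ i) • u = 0 →
      (∑ i ∈ Finset.range p, (1 + Y) ^ i) • v = 0 → X • v = Y • u →
      ∃ a : B, X • a = u ∧ Y • a = v) (b : B) : b = 0 := by
  have hpX := natCast_mul_eq_zero_of_one_add_pow_eq_one hXXX hodd hXp
  have hpY := natCast_mul_eq_zero_of_one_add_pow_eq_one hYYY hodd hYp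
  have hTXX : (∑ i ∈ Finset.range p, (1 + X) ^ i) * X = 0 := by
    have := geom_sum_mul (1 + X) p
    rwa [hXp, add_sub_cancel_left, sub_self] at this
  have hTYY : (∑ i ∈ Finset.range p, (1 + Y) ^ i) * Y = 0 := by
    have := geom_sum_mul (1 + Y) p
    rwa [hYp, add_sub_cancel_left, sub_self] at this
  have hTX := geom_sum_of_one_add_pow_eq_one hXXX hodd hXp
  have hTY := geom_sum_of_one_add_pow_eq_one hYYY hodd hYp
  set TX := ∑ i ∈ Finset.range p, (1 + X) ^ i
  set TY := ∑ i ∈ Finset.range p, (1 + Y) ^ i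
  have norm_fixed (w : B) (hXw : X • w = 0) (hYw : Y • w = 0) :
      ∃ t : B, X • t = 0 ∧ TY • t = w := by
    have key := LinearMap.ker_le_range_of_ker_le_range
      (f := LinearMap.lsmul R (LinearMap.ker (LinearMap.lsmul R B X)) Y)
      (g := LinearMap.lsmul R (LinearMap.ker (LinearMap.lsmul R B X)) TY) ?_ ?_
    · obtain ⟨⟨t, ht⟩, htw⟩ := @key ⟨w, hXw⟩ (Subtype.ext hYw)
      exact ⟨t, ht, congrArg Subtype.val htw⟩
    · rintro ⟨v, hv⟩ hTv
      obtain ⟨a, ha, rfl⟩ := H 0 v (smul_zero _) (congrArg Subtype.val hTv)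
        (by rw [smul_zero]; exact hv)
      exact ⟨⟨a, ha⟩, rfl⟩
    · rintro _ ⟨v, rfl⟩
      simp [smul_smul, hTYY]
  have lift_one (u w : B) (hu : TX • u = 0) (hw : X • w = Y • u) : ∃ a, X • a = u := by
    obtain ⟨t, ht, htw⟩ := norm_fixed (TY • w)
      (by rw [smul_comm, hw, smul_smul, hTYY, zero_smul])
      (by rw [smul_smul, mul_comm, hTYY, zero_smul])
    obtain ⟨a, ha, -⟩ := H u (w - t) hu (by rw [smul_sub, htw, sub_self])
      (by rw [smul_sub, ht, sub_zero, hw])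
    exact ⟨a, ha⟩
  have exact_X (u : B) (hu : TX • u = 0) : ∃ a, X • a = u := by
    have hYu (Z : R) : TX • Z • u = 0 := by rw [smul_comm, hu, smul_zero]
    obtain ⟨w, hw⟩ := lift_one (Y • Y • u) 0 (by simp [smul_smul, hYu])
      (by rw [smul_zero, smul_smul, smul_smul, ← pow_two, ← pow_succ, hYYY, zero_smul])
    obtain ⟨w, hw⟩ := lift_one (Y • u) w (hYu Y) hw
    exact lift_one u w hu hw
  have norm_X (w : B) (hw : X • w = 0) : ∃ t, TX • t = w := by
    refine LinearMap.ker_le_range_of_ker_le_range (f := LinearMap.lsmul R B X)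
      (g := LinearMap.lsmul R B TX) exact_X ?_ hw
    rintro _ ⟨v, rfl⟩
    simp [smul_smul, hTXX]
  have fixed (w : B) (hXw : X • w = 0) (hYw : Y • w = 0) : ∃ s : B, w = (p : R) ^ 2 • s := by
    obtain ⟨t, ht, rfl⟩ := norm_fixed w hXw hYw
    obtain ⟨s, rfl⟩ := norm_X t ht
    refine ⟨s, ?_⟩
    rw [smul_smul, hTX, hTY]
    congr 1
    linear_combination p.choose 3 * X * hpX + p.choose 3 * Y * hpY
      + p.choose 3 ^ 2 * Y * hXXY
  have fixed_X (w : B) (hw : X • w = 0) : ∃ s : B, w = (p : R) • s := by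
    obtain ⟨t, rfl⟩ := norm_X w hw
    obtain ⟨s, hs⟩ := fixed (X ^ 2 • t) (by rw [smul_smul, ← pow_succ', hXXX, zero_smul])
      (by rw [smul_smul, mul_comm, hXXY, zero_smul])
    refine ⟨t + ((p.choose 3 : R) * p) • s, ?_⟩
    rw [hTX, add_smul, mul_smul, hs, smul_add, smul_smul, smul_smul]
    congr 2
    ring
  have p_smul (c : B) : ∃ s : B, (p : R) • c = (p : R) ^ 2 • s :=
    fixed _ (by rw [smul_smul, mul_comm, hpX, zero_smul])
      (by rw [smul_smul, mul_comm, hpY, zero_smul])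
  have p_smul_pow (k : ℕ) (c : B) : ∃ s : B, (p : R) • c = (p : R) ^ (k + 1) • s := by
    induction k generalizing c with
    | zero => exact ⟨c, by simp⟩
    | succ k ih =>
      obtain ⟨s, hs⟩ := p_smul c
      obtain ⟨t, ht⟩ := ih s
      exact ⟨t, by rw [hs, pow_two, mul_smul, ht, smul_smul, ← pow_succ']⟩
  have p_smul_zero (c : B) : (p : R) • c = 0 := by
    obtain ⟨s, hs⟩ := p_smul_pow n c
    rw [hs, pow_succ', mul_smul, ← Nat.cast_pow, Nat.cast_smul_eq_nsmul R (p ^ n), hn, smul_zero]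
  have inj (w : B) (hw : X • w = 0) : w = 0 := by
    obtain ⟨s, rfl⟩ := fixed_X w hw
    exact p_smul_zero s
  refine inj _ (inj _ (inj _ ?_))
  rw [smul_smul, smul_smul, ← pow_two, ← pow_succ, hXXX, zero_smul]

/-- The crossed homomorphism on `ℕ × ℕ` with value `u` at the first generator, acting as `x`, and
`v` at the second generator, acting as `y`. -/
def crossedHomOfPair {R B : Type*} [CommRing R] [AddCommGroup B] [Module R B] (x y : R) (u v : B)
    (i j : ℕ) : B :=
  (y ^ j * ∑ k ∈ Finset.range i, x ^ k) • u + (∑ k ∈ Finset.range j, y ^ k) • v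

section
variable {R B : Type*} [CommRing R] [AddCommGroup B] [Module R B] {x y : R} {u v : B}

lemma crossedHomOfPair_add (h : (x - 1) • v = (y - 1) • u) (i j i' j' : ℕ) :
    crossedHomOfPair x y u v (i + i') (j + j') =
      (x ^ i' * y ^ j') • crossedHomOfPair x y u v i j + crossedHomOfPair x y u v i' j' := by
  have hS (z : R) (m n : ℕ) : ∑ k ∈ Finset.range (m + n), z ^ k =
      ∑ k ∈ Finset.range n, z ^ k + z ^ n * ∑ k ∈ Finset.range m, z ^ k := by
    rw [add_comm, Finset.sum_range_add, Finset.mul_sum]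
    simp only [pow_add]
  have hx := geom_sum_mul x i'
  have hy := geom_sum_mul y j
  simp only [crossedHomOfPair, hS]
  generalize ∑ k ∈ Finset.range i', x ^ k = a at *
  generalize ∑ k ∈ Finset.range j, y ^ k = b at *
  have hx' : (a * (x - 1)) • v = (x ^ i' - 1) • v := by rw [hx]
  have hy' : (b * (y - 1)) • u = (y ^ j - 1) • u := by rw [hy]
  linear_combination (norm := module)
    (-(y ^ j' * a * b)) • h + (y ^ j' * b) • hx' - (y ^ j' * a) • hy'

lemma crossedHomOfPair_mod {p : ℕ} (hx : x ^ p = 1) (hy : y ^ p = 1)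
    (hu : (∑ k ∈ Finset.range p, x ^ k) • u = 0) (hv : (∑ k ∈ Finset.range p, y ^ k) • v = 0)
    (i j : ℕ) : crossedHomOfPair x y u v (i % p) (j % p) = crossedHomOfPair x y u v i j := by
  have hS (z : R) (w : B) (hz : z ^ p = 1) (hw : (∑ k ∈ Finset.range p, z ^ k) • w = 0) (n : ℕ) :
      (∑ k ∈ Finset.range (n % p), z ^ k) • w = (∑ k ∈ Finset.range n, z ^ k) • w := by
    induction n using Nat.strong_induction_on with
    | _ n ih =>
      rcases lt_or_ge n p with h | h
      · rw [Nat.mod_eq_of_lt h]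
      · rcases p.eq_zero_or_pos with rfl | hp
        · simp
        · obtain ⟨m, rfl⟩ := Nat.exists_eq_add_of_le h
          rw [Nat.add_mod_left, ih m (by omega), Finset.sum_range_add, add_smul, hw, zero_add]
          simp only [pow_add, hz, one_mul]
  have hyj : y ^ (j % p) = y ^ j := by
    conv_rhs => rw [← Nat.mod_add_div j p, pow_add, pow_mul, hy, one_pow, mul_one]
  simp only [crossedHomOfPair, mul_smul, hS x u hx hu, hS y v hy hv, hyj]

end

/-- A maximal subgroup of a finite `p`-group is the kernel of a character of order `p`, which can
be normalized at any given element outside of it. -/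
lemma IsPGroup.exists_hom_zmod_of_isCoatom {p : ℕ} [Fact p.Prime] {G : Type*} [Group G] [Finite G]
    (hG : IsPGroup p G) {M : Subgroup G} (hM : IsCoatom M) {g : G} (hg : g ∉ M) :
    ∃ χ : G →* Multiplicative (ZMod p), χ.ker = M ∧ χ g = .ofAdd 1 := by
  have : Group.IsNilpotent G := hG.isNilpotent
  have hMn : M.Normal := Subgroup.NormalizerCondition.normal_of_coatom M
    Group.normalizerCondition_of_isNilpotent hM
  have hcard : Nat.card (G ⧸ M) = p := by
    obtain ⟨n, hn⟩ := (IsPGroup.iff_card (p := p)).mp (hG.to_subgroup M)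
    obtain ⟨k, hk⟩ := (IsPGroup.iff_card (p := p)).mp (hG.to_quotient M)
    have hk0 : k ≠ 0 := by
      rintro rfl
      exact hM.1 (Subgroup.index_eq_one.mp (by rw [Subgroup.index, hk, pow_zero]))
    have hmul := M.card_eq_card_quotient_mul_card_subgroup
    obtain ⟨K, hK, hMK⟩ := Sylow.exists_subgroup_card_pow_succ (p := p) (n := n) (G := G)
      (by rw [hmul, hk, hn, pow_succ']; gcongr; exact dvd_pow_self p hk0) hn
    have hKtop : K = ⊤ := hM.2 K <| lt_of_le_of_ne hMK fun h => by
      rw [← h, hn] at hK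
      exact absurd (Nat.pow_right_injective (Fact.out : p.Prime).two_le hK) (by omega)
    rw [hKtop, Subgroup.card_top, hmul, hn, pow_succ'] at hK
    exact Nat.eq_of_mul_eq_mul_right (pow_pos (Fact.out : p.Prime).pos n) hK
  let e : G ⧸ M ≃* Multiplicative (ZMod p) :=
    mulEquivOfPrimeCardEq (p := p) hcard (by simp)
  have hc : (e g).toAdd ≠ 0 := fun h => hg <| (QuotientGroup.eq_one_iff g).mp <|
    e.injective <| by rw [map_one]; exact h
  let m : Multiplicative (ZMod p) →* Multiplicative (ZMod p) :=
    AddMonoidHom.toMultiplicative (AddMonoidHom.mulLeft (e g).toAdd⁻¹)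
  have hm (z) : m z = .ofAdd ((e g).toAdd⁻¹ * z.toAdd) := rfl
  refine ⟨m.comp (e.toMonoidHom.comp (QuotientGroup.mk' M)), ?_, ?_⟩
  · ext x
    have : m (e x) = 1 ↔ x ∈ M := by
      rw [hm, ofAdd_eq_one, mul_eq_zero, or_iff_right (inv_ne_zero hc), toAdd_eq_zero,
        EmbeddingLike.map_eq_one_iff, QuotientGroup.eq_one_iff]
    exact this
  · change m (e g) = _
    rw [hm, inv_mul_cancel₀ hc]

/-- A noncyclic finite `p`-group maps onto `C_p × C_p`. -/
lemma IsPGroup.exists_dual_pair_of_not_isCyclic {p : ℕ} [Fact p.Prime] {G : Type*} [Group G]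
    [Finite G] (hG : IsPGroup p G) (hnc : ¬ IsCyclic G) :
    ∃ (χ ψ : G →* Multiplicative (ZMod p)) (g h : G),
      χ g = .ofAdd 1 ∧ χ h = 1 ∧ ψ g = 1 ∧ ψ h = .ofAdd 1 := by
  have not_unique (M : Subgroup G) (hM : IsCoatom M) : ∃ M', IsCoatom M' ∧ M' ≠ M := by
    by_contra! hall
    obtain ⟨g, -, hg⟩ := SetLike.exists_of_lt hM.lt_top
    refine hnc ⟨g, fun x => ?_⟩
    rcases eq_top_or_exists_le_coatom (Subgroup.zpowers g) with h | ⟨M', hM', hle⟩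
    · exact Subgroup.mem_zpowers_iff.mp (h ▸ Subgroup.mem_top x)
    · exact absurd (hall M' hM' ▸ hle (Subgroup.mem_zpowers g)) hg
  obtain ⟨M, hM, -⟩ : ∃ M : Subgroup G, IsCoatom M ∧ ⊥ ≤ M := by
    refine (eq_top_or_exists_le_coatom _).resolve_left fun h => hnc ⟨1, fun x => ?_⟩
    have : x ∈ (⊥ : Subgroup G) := h ▸ Subgroup.mem_top x
    exact ⟨0, by simp [Subgroup.mem_bot.mp this]⟩
  obtain ⟨M', hM', hne⟩ := not_unique M hM
  obtain ⟨g, hgM', hgM⟩ := SetLike.not_le_iff_exists.mp fun h =>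
    hM.1 ((hM'.le_iff.mp h).resolve_right hne.symm)
  obtain ⟨h, hhM, hhM'⟩ := SetLike.not_le_iff_exists.mp fun h =>
    hM'.1 ((hM.le_iff.mp h).resolve_right hne)
  obtain ⟨χ, hχ, hχg⟩ := hG.exists_hom_zmod_of_isCoatom hM hgM
  obtain ⟨ψ, hψ, hψh⟩ := hG.exists_hom_zmod_of_isCoatom hM' hhM'
  exact ⟨χ, ψ, g, h, hχg, by rwa [← MonoidHom.mem_ker, hχ],
    by rwa [← MonoidHom.mem_ker, hψ], hψh⟩

/-- A nontrivial normal subgroup of a finite `p`-group meets the center nontrivially. -/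
lemma IsPGroup.exists_mem_center_of_normal {p : ℕ} [Fact p.Prime] {G : Type*} [Group G] [Finite G]
    (hG : IsPGroup p G) {N : Subgroup G} [hN : N.Normal] (hnt : N ≠ ⊥) :
    ∃ z ∈ N, z ∈ Subgroup.center G ∧ z ≠ 1 := by
  have hdvd : p ∣ Nat.card N := by
    have := N.nontrivial_iff_ne_bot.mpr hnt
    obtain ⟨n, hn0, hn⟩ := (hG.to_subgroup N).nontrivial_iff_card.mp inferInstance
    exact hn ▸ dvd_pow_self p hn0.ne'
  have hG' := hG.of_equiv ConjAct.toConjAct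
  obtain ⟨z, hz, hz1⟩ := hG'.exists_fixed_point_of_prime_dvd_card_of_fixed_point
    N hdvd (a := 1) (fun g => smul_one g)
  refine ⟨z, z.2, Subgroup.mem_center_iff.mpr fun g => ?_, fun h => hz1 (Subtype.ext h.symm)⟩
  have := congrArg Subtype.val (hz (ConjAct.toConjAct g))
  rw [ConjAct.Subgroup.val_conj_smul, ConjAct.toConjAct_smul] at this
  exact mul_inv_eq_iff_eq_mul.mp this

section
open scoped IsMulCommutative

variable {G : Type*} [Group G] {B : Subgroup G}

lemma conjEnd_ext {φ ψ : AddMonoid.End (Additive B)}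
    (h : ∀ b, ((φ b).toMul : G) = (ψ b).toMul) : φ = ψ :=
  AddMonoidHom.ext fun b => Additive.toMul.injective (Subtype.ext (h b))

/-- The right conjugation action `b ↦ g⁻¹ * b * g` on an additively written normal subgroup. -/
def conjEnd (B : Subgroup G) [IsMulCommutative B] [B.Normal] (g : G) :
    AddMonoid.End (Additive B) :=
  MonoidHom.toAdditive (MulAut.conjNormal g⁻¹ : MulAut B).toMonoidHom

variable [IsMulCommutative B] [B.Normal]

lemma coe_conjEnd (g : G) (b : Additive B) :
    (((conjEnd B g) b).toMul : G) = g⁻¹ * b.toMul * g := by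
  change ((MulAut.conjNormal g⁻¹ b.toMul : B) : G) = _
  rw [MulAut.conjNormal_apply, inv_inv]

lemma coe_conjEnd_sub_one (g : G) (b : Additive B) :
    ((((conjEnd B g - 1 : AddMonoid.End (Additive B))) b).toMul : G) =
      g⁻¹ * b.toMul * g * (b.toMul : G)⁻¹ := by
  change (((conjEnd B g b - b).toMul : B) : G) = _
  rw [toMul_sub, Subgroup.coe_div, coe_conjEnd, div_eq_mul_inv]

lemma conjEnd_mul (g h : G) : conjEnd B (g * h) = conjEnd B h * conjEnd B g :=
  conjEnd_ext fun b => by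
    rw [AddMonoid.End.coe_mul, Function.comp_apply]
    simp only [coe_conjEnd]
    group

lemma conjEnd_one : conjEnd B 1 = 1 := conjEnd_ext fun b => by simp [coe_conjEnd]

lemma conjEnd_pow (g : G) (n : ℕ) : conjEnd B (g ^ n) = conjEnd B g ^ n := by
  induction n with
  | zero => simp [conjEnd_one]
  | succ n ih => rw [pow_succ', conjEnd_mul, ih, pow_succ]

lemma conjEnd_eq_one {g : G} (h : ∀ b ∈ B, g * b = b * g) : conjEnd B g = 1 :=
  conjEnd_ext fun b => by
    rw [coe_conjEnd, mul_assoc, ← h _ b.toMul.2, inv_mul_cancel_left]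
    rfl

lemma conjEnd_sub_one_mul_mul_eq_zero
    (hG : commutator (G ⧸ Subgroup.center G) ≤ Subgroup.center (G ⧸ Subgroup.center G))
    (x y z : G) : (conjEnd B x - 1) * (conjEnd B y - 1) * (conjEnd B z - 1) = 0 := by
  refine conjEnd_ext fun b => ?_
  simp only [AddMonoid.End.coe_mul, Function.comp_apply]
  rw [coe_conjEnd_sub_one x, coe_conjEnd_sub_one y, coe_conjEnd_sub_one z]
  generalize (b.toMul : G) = c
  let π := QuotientGroup.mk' (Subgroup.center G)
  have h1 : π (z⁻¹ * c * z * c⁻¹) ∈ Subgroup.center (G ⧸ Subgroup.center G) := by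
    refine hG ?_
    have := Subgroup.commutator_mem_commutator (Subgroup.mem_top (π z⁻¹)) (Subgroup.mem_top (π c))
    rw [commutatorElement_def] at this
    simpa [commutator_def] using this
  generalize z⁻¹ * c * z * c⁻¹ = d at *
  have h2 : y⁻¹ * d * y * d⁻¹ ∈ Subgroup.center G := by
    rw [← QuotientGroup.eq_one_iff]
    change π (y⁻¹ * d * y * d⁻¹) = 1
    have := Subgroup.mem_center_iff.mp h1 (π y⁻¹)
    simp only [map_mul, map_inv] at this ⊢
    rw [this]
    group
  have := Subgroup.mem_center_iff.mp h2 x⁻¹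
  rw [this, inv_mul_cancel_right, mul_inv_cancel]
  rfl

/-- The theorem for `G ⧸ N` mapping onto `C_p × C_p` by `χ` and `ψ`, with `s` and `t` lifting the
standard generators. -/
lemma exists_crossedHom_not_principal {p : ℕ} [Fact p.Prime] (hodd : Odd p) [Finite G]
    (hpG : IsPGroup p G)
    (hclass : commutator (G ⧸ Subgroup.center G) ≤ Subgroup.center (G ⧸ Subgroup.center G))
    {N : Subgroup G} [N.Normal] (hnt : N ≠ ⊥) {χ ψ : G →* Multiplicative (ZMod p)}
    (hχN : N ≤ χ.ker) (hψN : N ≤ ψ.ker) {s t : G}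
    (hχs : χ s = .ofAdd 1) (hχt : χ t = 1) (hψs : ψ s = 1) (hψt : ψ t = .ofAdd 1) :
    ∃ f : G → G,
      (∀ g : G, f g ∈ N ∧ ∀ m ∈ N, f g * m = m * f g) ∧
      (∀ x y : G, f (x * y) = y⁻¹ * f x * y * f y) ∧
      (∀ n ∈ N, f n = 1) ∧
      ¬ ∃ a : G, (a ∈ N ∧ ∀ m ∈ N, a * m = m * a) ∧
        ∀ g : G, f g = a⁻¹ * (g⁻¹ * a * g) := by
  let L : Subgroup G := χ.ker ⊓ ψ.ker
  have hNL : N ≤ L := le_inf hχN hψN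
  let B : Subgroup G := N ⊓ Subgroup.centralizer L
  have comm {b l : G} (hb : b ∈ B) (hl : l ∈ L) : l * b = b * l :=
    Subgroup.mem_centralizer_iff.mp hb.2 l hl
  have : IsMulCommutative B := ⟨⟨fun a b => Subtype.ext (comm b.2 (hNL a.2.1))⟩⟩
  have eq_one {l : G} (hl : l ∈ L) : conjEnd B l = 1 := conjEnd_eq_one fun b hb => comm hb hl
  have conj_eq {g h : G} (hχ : χ g = χ h) (hψ : ψ g = ψ h) : conjEnd B g = conjEnd B h := by
    have hl : h⁻¹ * g ∈ L := ⟨by simp [hχ], by simp [hψ]⟩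
    rw [← mul_inv_cancel_left h g, conjEnd_mul, eq_one hl, one_mul]
  let S := Subring.closure {conjEnd B s, conjEnd B t}
  have hcomm : conjEnd B s * conjEnd B t = conjEnd B t * conjEnd B s := by
    rw [← conjEnd_mul, ← conjEnd_mul]
    exact conj_eq (by simp [mul_comm]) (by simp [mul_comm])
  have : IsMulCommutative S := Subring.isMulCommutative_closure (by
    rintro _ (rfl | rfl) _ (rfl | rfl) <;> first | rfl | exact hcomm | exact hcomm.symm)
  let x : S := ⟨conjEnd B s, Subring.subset_closure (Or.inl rfl)⟩
  let y : S := ⟨conjEnd B t, Subring.subset_closure (Or.inr rfl)⟩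
  have one_pow_p : (Multiplicative.ofAdd (1 : ZMod p)) ^ p = 1 := by
    rw [← ofAdd_nsmul]
    simp
  have hx : x ^ p = 1 := Subtype.ext <| by
    change conjEnd B s ^ p = 1
    rw [← conjEnd_pow]
    exact eq_one ⟨by simp [hχs, one_pow_p], by simp [hψs]⟩
  have hy : y ^ p = 1 := Subtype.ext <| by
    change conjEnd B t ^ p = 1
    rw [← conjEnd_pow]
    exact eq_one ⟨by simp [hχt], by simp [hψt, one_pow_p]⟩
  have conj_smul (g : G) (b : Additive B) :
      conjEnd B g b = (x ^ (χ g).toAdd.val * y ^ (ψ g).toAdd.val) • b := by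
    have val_eq (z : Multiplicative (ZMod p)) : Multiplicative.ofAdd 1 ^ z.toAdd.val = z := by
      rw [← ofAdd_nsmul]
      simp
    rw [conj_eq (h := t ^ (ψ g).toAdd.val * s ^ (χ g).toAdd.val) (by simp [hχs, hχt, val_eq])
      (by simp [hψs, hψt, val_eq]), conjEnd_mul, conjEnd_pow, conjEnd_pow]
    rfl
  obtain ⟨n, hn⟩ := IsPGroup.iff_card.mp hpG
  by_contra hcon
  obtain ⟨z, hzN, hz, hz1⟩ := hpG.exists_mem_center_of_normal hnt
  have hzB : z ∈ B := ⟨hzN, Subgroup.center_le_centralizer _ hz⟩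
  suffices h : ∀ b : Additive B, b = 0 from
    hz1 (congrArg (fun b : Additive B => (b.toMul : G)) (h (.ofMul ⟨z, hzB⟩)))
  refine eq_zero_of_crossedHom_principal (R := S) (X := x - 1) (Y := y - 1) hodd ?_ ?_ ?_ ?_ ?_
    (n := n) ?_ ?_
  · exact Subtype.ext (by simpa [pow_succ] using conjEnd_sub_one_mul_mul_eq_zero hclass s s s)
  · exact Subtype.ext (by simpa [pow_succ] using conjEnd_sub_one_mul_mul_eq_zero hclass s s t)
  · exact Subtype.ext (by simpa [pow_succ] using conjEnd_sub_one_mul_mul_eq_zero hclass t t t)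
  · rwa [add_sub_cancel]
  · rwa [add_sub_cancel]
  · intro b
    refine Additive.toMul.injective (Subtype.ext ?_)
    rw [toMul_nsmul, SubmonoidClass.coe_pow, ← hn, pow_card_eq_one']
    rfl
  intro u v hu hv huv
  simp only [add_sub_cancel] at hu hv
  by_contra hno
  let F (g : G) : Additive B := crossedHomOfPair x y u v (χ g).toAdd.val (ψ g).toAdd.val
  have hF (g h : G) : F (g * h) = conjEnd B h (F g) + F h := by
    simp only [F]
    rw [conj_smul, ← crossedHomOfPair_add huv, ← crossedHomOfPair_mod hx hy hu hv (_ + _)]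
    simp [ZMod.val_add]
  have F_L {l : G} (hl : l ∈ L) : F l = 0 := by
    have h1 : χ l = 1 := hl.1
    have h2 : ψ l = 1 := hl.2
    simp [F, h1, h2, crossedHomOfPair]
  have F_s : F s = u := by simp [F, hχs, hψs, crossedHomOfPair, ZMod.val_one]
  have F_t : F t = v := by simp [F, hχt, hψt, crossedHomOfPair, ZMod.val_one]
  refine hcon ⟨fun g => ((F g).toMul : G), fun g => ⟨(F g).toMul.2.1, fun m hm =>
    (comm (F g).toMul.2 (hNL hm)).symm⟩, fun g h => ?_, fun m hm => ?_, ?_⟩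
  · simp only [hF, toMul_add, Subgroup.coe_mul, coe_conjEnd]
  · simp only [F_L (hNL hm)]
    rfl
  rintro ⟨a, ⟨haN, -⟩, ha⟩
  have haB : a ∈ B := by
    refine ⟨haN, Subgroup.mem_centralizer_iff.mpr fun l hl => ?_⟩
    have h := ha l
    simp only [F_L hl] at h
    have h' : l⁻¹ * a * l = a := (inv_mul_eq_one.mp h.symm).symm
    rw [mul_assoc, inv_mul_eq_iff_eq_mul] at h'
    exact h'.symm
  have hsub (g : G) : (conjEnd B g - 1 : AddMonoid.End (Additive B)) (.ofMul ⟨a, haB⟩) = F g := by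
    refine Additive.toMul.injective (Subtype.ext ?_)
    refine (coe_conjEnd_sub_one g _).trans (Eq.trans ?_ (ha g).symm)
    have hg : g⁻¹ * a * g ∈ B := by
      simpa using (inferInstance : B.Normal).conj_mem a haB g⁻¹
    exact (comm hg (hNL (inv_mem haN))).symm
  exact hno ⟨.ofMul ⟨a, haB⟩, (hsub s).trans F_s, (hsub t).trans F_t⟩

end

/-- Let `p` be odd and `G` a finite `p`-group with `G/Z(G)` of
nilpotency class at most 2, and let `N` be a nontrivial normal subgroup with
`G/N` non-cyclic. Then there is a non-principal crossed homomorphism of `G/N`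
with values in `Z(N)`; i.e. `H¹(G/N, Z(N)) ≠ 0`. -/
theorem stmt17 {p : ℕ} (hp : p.Prime) (hodd : Odd p) (G : Type*) [Group G] [Finite G]
    (hpG : IsPGroup p G)
    (hclass : commutator (G ⧸ Subgroup.center G) ≤
      Subgroup.center (G ⧸ Subgroup.center G))
    (N : Subgroup G) (hN : N.Normal) (hnt : N ≠ ⊥)
    (hnc : ¬ IsCyclic (G ⧸ N)) :
    ∃ f : G → G,
      (∀ g : G, f g ∈ N ∧ ∀ m ∈ N, f g * m = m * f g) ∧
      (∀ x y : G, f (x * y) = y⁻¹ * f x * y * f y) ∧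
      (∀ n ∈ N, f n = 1) ∧
      ¬ ∃ a : G, (a ∈ N ∧ ∀ m ∈ N, a * m = m * a) ∧
        ∀ g : G, f g = a⁻¹ * (g⁻¹ * a * g) := by
  have : Fact p.Prime := ⟨hp⟩
  obtain ⟨χ, ψ, s, t, hχs, hχt, hψs, hψt⟩ :=
    (hpG.to_quotient N).exists_dual_pair_of_not_isCyclic hnc
  obtain ⟨s, rfl⟩ := QuotientGroup.mk'_surjective N s
  obtain ⟨t, rfl⟩ := QuotientGroup.mk'_surjective N t
  have ker_le (φ : G ⧸ N →* Multiplicative (ZMod p)) : N ≤ (φ.comp (QuotientGroup.mk' N)).ker :=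
    fun m hm => by
      rw [MonoidHom.mem_ker, MonoidHom.comp_apply, QuotientGroup.mk'_apply,
        (QuotientGroup.eq_one_iff m).mpr hm, map_one]
  exact exists_crossedHom_not_principal hodd hpG hclass hnt (ker_le χ) (ker_le ψ)
    hχs hχt hψs hψt
end

section
/- Let p be an odd prime and let G be a finite p-group such that G/Z(G) is p-central, i.e., every element of order p in G/Z(G) lies in the center of G/Z(G). Let f : G → G be a map such that: (i) for every g ∈ G, f(g) lies in Z(Φ(G)) = {n ∈ Φ(G) : n commutes with every element of Φ(G)}; (ii) f(xy) = (y⁻¹ f(x) y) · f(y) for all x, y ∈ G; and (iii) f(t) = 1 for all t ∈ Φ(G). Then f(x)^p = 1 for every x ∈ G. (That is, the group Z¹(G/Φ(G), Z(Φ(G))) of crossed homomorphisms is an elementary abelian p-group.) -/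
/-- If `x⁻¹ * b * x = b * c` with `c` central, then `(x * b) ^ n` can be collected. -/
theorem mul_pow_of_conj_eq_mul_center {H : Type*} [Group H] {x b c : H}
    (hc : c ∈ Subgroup.center H) (hb : b * x = x * (b * c)) (n : ℕ) :
    (x * b) ^ n = x ^ n * b ^ n * c ^ (∑ i ∈ Finset.range n, i) := by
  have hcomm : ∀ g : H, Commute c g := fun g => (Subgroup.mem_center_iff.1 hc g).symm
  induction n with
  | zero => simp
  | succ n ih =>
    have hbn : b ^ n * x = x * (b ^ n * c ^ n) := by
      rw [← (hcomm b).symm.mul_pow]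
      exact (show SemiconjBy x (b * c) b from hb.symm).pow_right n |>.symm
    rw [pow_succ, ih, Finset.sum_range_succ, pow_add c]
    calc x ^ n * b ^ n * c ^ (∑ i ∈ Finset.range n, i) * (x * b)
        = x ^ n * (b ^ n * x) * b * c ^ (∑ i ∈ Finset.range n, i) := by
          rw [mul_assoc (x ^ n * b ^ n), ((hcomm (x * b)).pow_left _).eq]
          simp only [mul_assoc]
      _ = x ^ n * x * b ^ n * (c ^ n * b) * c ^ (∑ i ∈ Finset.range n, i) := by
          rw [hbn]; simp only [mul_assoc]
      _ = x ^ (n + 1) * b ^ (n + 1) *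
            (c ^ (∑ i ∈ Finset.range n, i) * c ^ n) := by
          rw [((hcomm b).pow_left n).eq, ← pow_add c, add_comm _ n, pow_add c,
            pow_succ x, pow_succ b]
          simp only [mul_assoc]

theorem pow_eq_one_of_conj_eq_mul_center {H : Type*} [Group H] {p : ℕ} (hodd : Odd p)
    {x b c : H} (hc : c ∈ Subgroup.center H) (hcp : c ^ p = 1) (hb : b * x = x * (b * c))
    (h : (x * b) ^ p = x ^ p) : b ^ p = 1 := by
  obtain ⟨m, rfl⟩ := hodd
  have hsum : ∑ i ∈ Finset.range (2 * m + 1), i = (2 * m + 1) * m := by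
    rw [Finset.sum_range_id, Nat.add_sub_cancel, mul_left_comm, Nat.mul_div_cancel_left _ two_pos]
  rw [mul_pow_of_conj_eq_mul_center hc hb, hsum, pow_mul, hcp, one_pow, mul_one] at h
  exact mul_eq_left.1 h

/-- In a `p`-central group with `p` odd, an element whose powers all have trivial norm under
conjugation by `x` is killed by `p`. -/
theorem pow_eq_one_of_pCentral {H : Type*} [Group H] {p : ℕ} (hodd : Odd p)
    (hcent : ∀ y : H, y ^ p = 1 → y ∈ Subgroup.center H) {x b : H}
    (hcomm : Commute b (x⁻¹ * b * x)) (h : ∀ k : ℕ, (x * b ^ k) ^ p = x ^ p) (n : ℕ)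
    (hn : b ^ p ^ (n + 1) = 1) : b ^ p = 1 := by
  induction n with
  | zero => simpa using hn
  | succ n ih =>
    apply ih
    set d := b ^ p ^ n with hd
    have hconj : x⁻¹ * d * x = (x⁻¹ * b * x) ^ p ^ n := by
      simpa using (conj_pow (a := x⁻¹) (b := b) (i := p ^ n)).symm
    have hcd : Commute d (x⁻¹ * d * x) := by
      rw [hconj]; exact hcomm.pow_pow _ _
    have hdp : d ^ p ∈ Subgroup.center H := by
      apply hcent
      rw [hd, ← pow_mul, ← pow_mul, ← sq, ← pow_add, hn]
    have hcp : (d⁻¹ * (x⁻¹ * d * x)) ^ p = 1 := by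
      rw [hcd.inv_left.mul_pow, inv_pow]
      have : (x⁻¹ * d * x) ^ p = x⁻¹ * d ^ p * x := by
        simpa using conj_pow (a := x⁻¹) (b := d) (i := p)
      rw [this, mul_assoc x⁻¹, ← Subgroup.mem_center_iff.1 hdp x]
      group
    have := pow_eq_one_of_conj_eq_mul_center (x := x) (b := d) hodd (hcent _ hcp) hcp
      (by simp only [mul_assoc, mul_inv_cancel_left]) (h (p ^ n))
    rwa [← pow_mul, ← pow_succ] at this

theorem IsPGroup.pow_mem_frattini {p : ℕ} (hp : p.Prime) {G : Type*} [Group G] [Finite G]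
    (hpG : IsPGroup p G) (x : G) : x ^ p ∈ frattini G := by
  have : Fact p.Prime := ⟨hp⟩
  have hnil : Group.IsNilpotent G := hpG.isNilpotent
  simp only [frattini, Order.radical, Subgroup.mem_iInf]
  intro K hK
  have hN : K.Normal := Subgroup.NormalizerCondition.normal_of_coatom K
    Group.normalizerCondition_of_isNilpotent hK
  by_contra hx
  have htop : K ⊔ Subgroup.zpowers (x ^ p) = ⊤ := hK.2 _ <| lt_of_le_of_ne le_sup_left fun h =>
    hx (h ▸ Subgroup.mem_sup_right (Subgroup.mem_zpowers _))
  obtain ⟨k, hk, _, ⟨j, rfl⟩, hkx⟩ := Subgroup.mem_sup_of_normal_left.1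
    (htop ▸ Subgroup.mem_top x : x ∈ K ⊔ Subgroup.zpowers (x ^ p))
  have hxk : x ^ (1 - p * j) ∈ K := by
    have : x ^ (1 - (p : ℤ) * j) = k := by
      rw [zpow_sub, zpow_one, zpow_mul, zpow_natCast]
      exact (eq_mul_inv_of_mul_eq hkx).symm
    rwa [this]
  obtain ⟨n, hn⟩ := hpG x
  have hcop : IsCoprime (1 - (p : ℤ) * j) ((p : ℤ) ^ n) :=
    IsCoprime.pow_right ⟨1, j, by ring⟩
  obtain ⟨a, b, hab⟩ := hcop
  have hxK : x ∈ K := by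
    have hxn : x ^ ((p : ℤ) ^ n) = 1 := by exact_mod_cast hn
    rw [← zpow_one x, ← hab, zpow_add, mul_comm a, zpow_mul, mul_comm b, zpow_mul x, hxn,
      one_zpow, mul_one]
    exact K.zpow_mem hxk a
  exact hx (K.pow_mem hxK p)

/-- Let `p` be odd and `G` a finite `p`-group with `G/Z(G)`
`p`-central. Then every crossed homomorphism `f` of `G/Φ(G)` with values in
`Z(Φ(G))` satisfies `f x ^ p = 1` for all `x`; i.e. `Z¹(G/Φ(G), Z(Φ(G)))` is
elementary abelian. -/
theorem stmt19 {p : ℕ} (hp : p.Prime) (hodd : Odd p) (G : Type*) [Group G] [Finite G]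
    (hpG : IsPGroup p G)
    (hcent : ∀ x : G ⧸ Subgroup.center G, x ^ p = 1 →
      x ∈ Subgroup.center (G ⧸ Subgroup.center G))
    (f : G → G)
    (hmem : ∀ g : G, f g ∈ frattini G ∧ ∀ m ∈ frattini G, f g * m = m * f g)
    (hcocycle : ∀ x y : G, f (x * y) = y⁻¹ * f x * y * f y)
    (hvanish : ∀ t ∈ frattini G, f t = 1) :
    ∀ x : G, f x ^ p = 1 := by
  intro x
  have hfc : ∀ g y : G, Commute (y⁻¹ * f g * y) (f y) := fun g y => by
    have hm : y⁻¹ * f g * y ∈ frattini G := by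
      simpa using (inferInstance : (frattini G).Normal).conj_mem _ (hmem g).1 y⁻¹
    exact ((hmem y).2 _ hm).symm
  have hpow : ∀ k n : ℕ, (x * f x ^ k) ^ n = x ^ n * f (x ^ n) ^ k := fun k n => by
    induction n with
    | zero => simp [hvanish 1 (one_mem _)]
    | succ n ih =>
      have : (x⁻¹ * f (x ^ n) * x) ^ k = x⁻¹ * f (x ^ n) ^ k * x := by
        simpa using conj_pow (a := x⁻¹) (b := f (x ^ n)) (i := k)
      rw [pow_succ, ih, pow_succ x, hcocycle, (hfc _ _).mul_pow, this]
      group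
  have hxp : f (x ^ p) = 1 := hvanish _ (hpG.pow_mem_frattini hp x)
  have hnorm : ∀ k : ℕ, (x * f x ^ k) ^ p = x ^ p := fun k => by
    rw [hpow, hxp, one_pow, mul_one]
  obtain ⟨n, hn⟩ := hpG (f x)
  have hquot : (f x : G ⧸ Subgroup.center G) ^ p = 1 := by
    refine pow_eq_one_of_pCentral hodd hcent (x := (x : G ⧸ Subgroup.center G)) ?_ (fun k => ?_) n ?_
    · exact (hfc x x).symm.map (QuotientGroup.mk' (Subgroup.center G))
    · exact congrArg (QuotientGroup.mk' (Subgroup.center G)) (hnorm k)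
    · refine congrArg (QuotientGroup.mk' (Subgroup.center G)) (a₁ := f x ^ p ^ (n + 1)) (a₂ := 1) ?_
      rw [pow_succ, pow_mul, hn, one_pow]
  have hap : f x ^ p ∈ Subgroup.center G := (QuotientGroup.eq_one_iff _).1 hquot
  have hc : (f x)⁻¹ * (x⁻¹ * f x * x) ∈ Subgroup.center G := by
    rw [← QuotientGroup.eq_one_iff]
    have := Subgroup.mem_center_iff.1 (hcent _ hquot) (x : G ⧸ Subgroup.center G)
    simp only [QuotientGroup.mk_mul, QuotientGroup.mk_inv]
    rw [mul_assoc _ _ (x : G ⧸ Subgroup.center G), ← this]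
    group
  refine pow_eq_one_of_conj_eq_mul_center (x := x) (b := f x) hodd hc ?_
    (by simp only [mul_assoc, mul_inv_cancel_left]) (by simpa using hnorm 1)
  have : (x⁻¹ * f x * x) ^ p = x⁻¹ * f x ^ p * x := by
    simpa using conj_pow (a := x⁻¹) (b := f x) (i := p)
  rw [(hfc x x).symm.inv_left.mul_pow, this, mul_assoc x⁻¹,
    ← Subgroup.mem_center_iff.1 hap x]
  group
end
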